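/- Let J : ℚ_p^n → [0,∞) satisfy Hypothesis A and assume that ξ ↦ 1 − (FJ)(ξ) is nondecreasing as a function of ‖ξ‖_p. Let u_0, v_0 : ℚ_p^n → ℝ be locally constant compactly supported functions with u_0(x) ≥ v_0(x) for all x, and set u(x,t) = ∫_{ℚ_p^n} χ_p(−ξ·x) e^{−t(1−(FJ)(ξ))} (Fu_0)(ξ) d^n ξ and v(x,t) = ∫_{ℚ_p^n} χ_p(−ξ·x) e^{−t(1−(FJ)(ξ))} (Fv_0)(ξ) d^n ξ. Then u(x,t) ≥ v(x,t) for all x ∈ ℚ_p^n and all t ≥ 0 (comparison principle). -/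

import Mathlib

open MeasureTheory Filter

noncomputable section

namespace PadicPaper

attribute [local instance] Classical.propDecidable

variable (p : ℕ) [Fact p.Prime]

instance : MeasurableSpace ℚ_[p] := borel _
instance : BorelSpace ℚ_[p] := ⟨rfl⟩

variable (n : ℕ)

/-- `ℚ_p^n` with the sup norm `‖x‖ = max |x i|_p`. -/
abbrev V := Fin n → ℚ_[p]

/-- The `p`-adic fractional part of `y`: the unique rational `r ∈ [0,1)` whose denominator is a
power of `p` such that `y - r ∈ ℤ_p`. -/
def frac (y : ℚ_[p]) : ℚ :=
  if h : ∃ r : ℚ, 0 ≤ r ∧ r < 1 ∧ (∃ m : ℕ, (r * (p : ℚ) ^ m).den = 1) ∧ ‖y - (r : ℚ_[p])‖ ≤ 1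
  then h.choose else 0

/-- The standard additive character `χ_p(y) = exp(2 π i {y}_p)` of `ℚ_p`. -/
def stdChar (y : ℚ_[p]) : ℂ := Complex.exp (2 * Real.pi * Complex.I * (frac p y : ℂ))

/-- `ξ·x = Σ ξ_i x_i`. -/
def dotP (ξ x : V p n) : ℚ_[p] := ∑ i, ξ i * x i

/-- Fourier transform with respect to the (normalized Haar) measure `μ`:
`(Ff)(ξ) = ∫ χ_p(ξ·x) f(x) dμ(x)`. -/
def FT (μ : Measure (V p n)) (f : V p n → ℂ) (ξ : V p n) : ℂ :=
  ∫ x, stdChar p (dotP p n ξ x) * f x ∂μ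

/-- `ℤ_p^n` as a subset of `ℚ_p^n`. -/
def Zpn : Set (V p n) := {x | ‖x‖ ≤ 1}

/-- Hypothesis A: `J` is a nonnegative radial a.e.-continuous function with total integral 1. -/
structure HypA (μ : Measure (V p n)) (J : V p n → ℝ) : Prop where
  nonneg : ∀ x, 0 ≤ J x
  radial : ∀ x y : V p n, ‖x‖ = ‖y‖ → J x = J y
  aecont : ∀ᵐ x ∂μ, ContinuousAt J x
  integrable : Integrable J μ
  int_one : ∫ x, J x ∂μ = 1

/-- The Fourier transform of (the complexification of) `J`. -/
def FJ (μ : Measure (V p n)) (J : V p n → ℝ) (ξ : V p n) : ℂ :=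
  FT p n μ (fun x => (J x : ℂ)) ξ

/-- A representative point of `ℚ_p^n` of norm `r` (junk value `0` if no such point exists);
used to evaluate radial functions at a given radius. -/
def repVec (r : ℝ) : V p n :=
  if h : ∃ v : V p n, ‖v‖ = r then h.choose else 0

/-- The heat kernel
`Z_t(x) = ‖x‖^{-n} (1-p^{-n}) Σ_{j≥0} p^{-nj} (e^{-t(1-(FJ)(p^{-j}‖x‖⁻¹))} - e^{-t(1-(FJ)(p‖x‖⁻¹))})`. -/
def heatZ (μ : Measure (V p n)) (J : V p n → ℝ) (t : ℝ) (x : V p n) : ℝ :=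
  ‖x‖ ^ (-(n : ℤ)) * (1 - (p : ℝ) ^ (-(n : ℤ))) * ∑' j : ℕ,
    (p : ℝ) ^ (-((n * j : ℕ) : ℤ)) *
      (Real.exp (-(t * (1 - (FJ p n μ J (repVec p n ((p : ℝ) ^ (-(j : ℤ)) * ‖x‖⁻¹))).re))) -
       Real.exp (-(t * (1 - (FJ p n μ J (repVec p n ((p : ℝ) * ‖x‖⁻¹))).re))))

/-- `J` is of linear type: Hypothesis A together with `B‖x‖^{-(α+1)} ≤ J(x) ≤ C‖x‖^{-(α+1)}`. -/
structure LinearType (μ : Measure (V p n)) (J : V p n → ℝ) (B C α : ℝ) : Prop where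
  hypA : HypA p n μ J
  hB : 0 < B
  hBC : B ≤ C
  hα : 0 < α
  lower : ∀ x : V p n, x ≠ 0 → B / ‖x‖ ^ (α + 1) ≤ J x
  upper : ∀ x : V p n, x ≠ 0 → J x ≤ C / ‖x‖ ^ (α + 1)

/-- `J` is of logarithmic type: Hypothesis A together with
`D ln^α(1+‖x‖)‖x‖^{-β} ≤ J(x) ≤ E ln^α(1+‖x‖)‖x‖^{-β}`. -/
structure LogType (μ : Measure (V p n)) (J : V p n → ℝ) (D E α β : ℝ) : Prop where
  hypA : HypA p n μ J
  hD : 0 < D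
  hDE : D ≤ E
  hα : 0 < α
  hβ : 0 < β
  lower : ∀ x : V p n, x ≠ 0 → D * Real.log (1 + ‖x‖) ^ α / ‖x‖ ^ β ≤ J x
  upper : ∀ x : V p n, x ≠ 0 → J x ≤ E * Real.log (1 + ‖x‖) ^ α / ‖x‖ ^ β

/-- The lower incomplete gamma function `γ(s,x) = ∫_0^x z^{s-1} e^{-z} dz`. -/
def lgamma (s x : ℝ) : ℝ := ∫ z in (0:ℝ)..x, z ^ (s - 1) * Real.exp (-z)


/-! ### Helper lemmas -/

theorem norm_sub_le_max' (a b : ℚ_[p]) : ‖a - b‖ ≤ max ‖a‖ ‖b‖ := by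
  rw [sub_eq_add_neg, ← norm_neg b]
  exact IsUltrametricDist.norm_add_le_max a (-b)

theorem frac_spec (y : ℚ_[p]) :
    0 ≤ frac p y ∧ frac p y < 1 ∧ (∃ m : ℕ, (frac p y * (p : ℚ) ^ m).den = 1) ∧
      ‖y - ((frac p y : ℚ) : ℚ_[p])‖ ≤ 1 := by
  have hp : 0 < p := (Fact.out : p.Prime).pos
  have hp0 : (p : ℚ) ≠ 0 := by exact_mod_cast hp.ne'
  have hp0' : (p : ℚ_[p]) ≠ 0 := by exact_mod_cast hp.ne'
  have h : ∃ r : ℚ, 0 ≤ r ∧ r < 1 ∧ (∃ m : ℕ, (r * (p : ℚ) ^ m).den = 1) ∧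
      ‖y - (r : ℚ_[p])‖ ≤ 1 := by
    obtain ⟨m, hm⟩ : ∃ m : ℕ, ‖(p : ℚ_[p]) ^ m * y‖ ≤ 1 := by
      have h1 : (1 : ℝ) < p := by exact_mod_cast (Fact.out : p.Prime).one_lt
      obtain ⟨m, hm⟩ := pow_unbounded_of_one_lt ‖y‖ h1
      refine ⟨m, ?_⟩
      have hpm : (0 : ℝ) < (p : ℝ) ^ m := by positivity
      rw [norm_mul, norm_pow, Padic.norm_p, inv_pow, inv_mul_le_iff₀ hpm]
      linarith
    set z : ℤ_[p] := ⟨(p : ℚ_[p]) ^ m * y, hm⟩ with hz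
    refine ⟨(z.appr m : ℚ) / (p : ℚ) ^ m, by positivity, ?_, ⟨m, ?_⟩, ?_⟩
    · rw [div_lt_one (by positivity)]
      exact_mod_cast z.appr_lt m
    · rw [div_mul_cancel₀ _ (pow_ne_zero _ hp0)]
      exact Rat.den_natCast _
    · have h1 := z.appr_spec m
      rw [Ideal.mem_span_singleton] at h1
      obtain ⟨c, hc⟩ := h1
      have h2 := congrArg (fun w : ℤ_[p] => (w : ℚ_[p])) hc
      simp only [PadicInt.coe_sub, PadicInt.coe_mul, PadicInt.coe_pow, PadicInt.coe_natCast] at h2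
      have h3 : y - (((z.appr m : ℚ) / (p : ℚ) ^ m : ℚ) : ℚ_[p]) = (c : ℚ_[p]) := by
        have h4 : (p : ℚ_[p]) ^ m ≠ 0 := pow_ne_zero _ hp0'
        apply mul_left_cancel₀ h4
        rw [← h2, hz]
        push_cast
        field_simp
      rw [h3]
      exact c.2
  unfold frac
  rw [dif_pos h]
  exact h.choose_spec

theorem int_of_norm_le (q : ℚ) (m : ℕ) (a : ℤ) (h : q * (p : ℚ) ^ m = a)
    (hq : ‖(q : ℚ_[p])‖ ≤ 1) : ∃ k : ℤ, q = k := by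
  have hp : 0 < p := (Fact.out : p.Prime).pos
  have hp0 : (p : ℚ) ≠ 0 := by exact_mod_cast hp.ne'
  have h1 : ‖(a : ℚ_[p])‖ ≤ (p : ℝ) ^ (-m : ℤ) := by
    have : (a : ℚ_[p]) = (q : ℚ_[p]) * (p : ℚ_[p]) ^ m := by exact_mod_cast h.symm
    rw [this, norm_mul, norm_pow, Padic.norm_p, zpow_neg, zpow_natCast, inv_pow]
    exact mul_le_of_le_one_left (by positivity) hq
  rw [Padic.norm_int_le_pow_iff_dvd] at h1
  obtain ⟨k, hk⟩ := h1
  refine ⟨k, ?_⟩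
  apply mul_right_cancel₀ (pow_ne_zero m hp0)
  rw [h, hk]
  push_cast
  ring

theorem den_one_int (q : ℚ) (h : q.den = 1) : ∃ a : ℤ, q = a :=
  ⟨q.num, (Rat.den_eq_one_iff q).1 h |>.symm⟩

theorem frac_int (y : ℚ_[p]) : ∃ (m : ℕ) (a : ℤ), frac p y * (p : ℚ) ^ m = a := by
  obtain ⟨-, -, ⟨m, hm⟩, -⟩ := frac_spec p y
  obtain ⟨a, ha⟩ := den_one_int _ hm
  exact ⟨m, a, ha⟩

theorem stdChar_add (a b : ℚ_[p]) : stdChar p (a + b) = stdChar p a * stdChar p b := by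
  obtain ⟨k, hk⟩ : ∃ k : ℤ, frac p (a + b) - (frac p a + frac p b) = k := by
    obtain ⟨m1, c1, h1⟩ := frac_int p a
    obtain ⟨m2, c2, h2⟩ := frac_int p b
    obtain ⟨m3, c3, h3⟩ := frac_int p (a + b)
    refine int_of_norm_le p _ (m1 + m2 + m3)
      (c3 * p ^ (m1 + m2) - (c1 * p ^ (m2 + m3) + c2 * p ^ (m1 + m3))) ?_ ?_
    · push_cast
      rw [← h1, ← h2, ← h3]
      ring
    · have e1 := (frac_spec p a).2.2.2
      have e2 := (frac_spec p b).2.2.2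
      have e3 := (frac_spec p (a + b)).2.2.2
      have : ((frac p (a + b) - (frac p a + frac p b) : ℚ) : ℚ_[p]) =
          ((a - (frac p a : ℚ)) + (b - (frac p b : ℚ))) - (a + b - (frac p (a + b) : ℚ)) := by
        push_cast
        ring
      rw [this]
      refine (norm_sub_le_max' p _ _).trans (max_le ?_ e3)
      exact (IsUltrametricDist.norm_add_le_max _ _).trans (max_le e1 e2)
  have hk' : (frac p (a + b) : ℂ) = frac p a + frac p b + k := by
    have : frac p (a + b) = frac p a + frac p b + k := by linarith
    exact_mod_cast this
  unfold stdChar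
  rw [← Complex.exp_add, hk']
  have : (2 * Real.pi * Complex.I * ((frac p a : ℂ) + frac p b + k)) =
      (2 * Real.pi * Complex.I * (frac p a : ℂ) + 2 * Real.pi * Complex.I * (frac p b : ℂ)) +
        k * (2 * Real.pi * Complex.I) := by ring
  rw [this, Complex.exp_add _ (k * _), Complex.exp_int_mul_two_pi_mul_I, mul_one]

theorem stdChar_norm (a : ℚ_[p]) : ‖stdChar p a‖ = 1 := by
  unfold stdChar
  rw [show (2 * Real.pi * Complex.I * (frac p a : ℂ)) =
    ((2 * Real.pi * (frac p a : ℝ) : ℝ) : ℂ) * Complex.I by push_cast; ring]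
  exact Complex.norm_exp_ofReal_mul_I _

theorem stdChar_ne (a : ℚ_[p]) : stdChar p a ≠ 0 := Complex.exp_ne_zero _

theorem stdChar_zero : stdChar p 0 = 1 := by
  have h := stdChar_add p 0 0
  rw [add_zero] at h
  exact (mul_eq_left₀ (stdChar_ne p 0)).1 h.symm

theorem stdChar_eq_one_of_norm_le (a : ℚ_[p]) (ha : ‖a‖ ≤ 1) : stdChar p a = 1 := by
  obtain ⟨m, c, h⟩ := frac_int p a
  obtain ⟨k, hk⟩ := int_of_norm_le p (frac p a) m c h (by
    have e1 := (frac_spec p a).2.2.2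
    have : ((frac p a : ℚ) : ℚ_[p]) = a - (a - (frac p a : ℚ)) := by ring
    rw [this]
    exact (norm_sub_le_max' p _ _).trans (max_le ha e1))
  unfold stdChar
  rw [hk]
  rw [show (2 * Real.pi * Complex.I * (((k : ℤ) : ℚ) : ℂ)) = k * (2 * Real.pi * Complex.I) by
    push_cast; ring]
  exact Complex.exp_int_mul_two_pi_mul_I k

theorem norm_le_of_stdChar_eq_one (a : ℚ_[p]) (h : stdChar p a = 1) : ‖a‖ ≤ 1 := by
  unfold stdChar at h
  obtain ⟨k, hk⟩ := Complex.exp_eq_one_iff.1 h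
  have h0 : (frac p a : ℂ) = k := by
    have : (2 * Real.pi * Complex.I : ℂ) ≠ 0 := Complex.two_pi_I_ne_zero
    apply mul_left_cancel₀ this
    rw [hk]; ring
  have h1 : frac p a = k := by exact_mod_cast h0
  have e1 := (frac_spec p a).2.2.2
  have : a = (a - (frac p a : ℚ)) + ((frac p a : ℚ) : ℚ_[p]) := by ring
  rw [this]
  refine (IsUltrametricDist.norm_add_le_max _ _).trans (max_le e1 ?_)
  rw [h1]
  have := Padic.norm_int_le_one (p := p) k
  exact_mod_cast this

theorem stdChar_continuous : Continuous (stdChar p) := by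
  rw [continuous_iff_continuousAt]
  intro a
  have : stdChar p =ᶠ[nhds a] fun _ => stdChar p a := by
    filter_upwards [Metric.ball_mem_nhds a one_pos] with b hb
    have h1 : ‖b - a‖ ≤ 1 := by
      rw [← dist_eq_norm]; exact (Metric.mem_ball.1 hb).le
    have h2 := stdChar_add p (b - a) a
    rw [sub_add_cancel, stdChar_eq_one_of_norm_le p _ h1, one_mul] at h2
    exact h2
  exact continuousAt_const.congr this.symm

theorem stdChar_conj (a : ℚ_[p]) : (starRingEnd ℂ) (stdChar p a) = stdChar p (-a) := by
  have h := stdChar_add p a (-a)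
  rw [add_neg_cancel, stdChar_zero] at h
  have h2 : stdChar p a * (starRingEnd ℂ) (stdChar p a) = 1 := by
    rw [Complex.mul_conj, Complex.normSq_eq_norm_sq, stdChar_norm]; simp
  exact mul_left_cancel₀ (stdChar_ne p a) (h2.trans h)

theorem dotP_add_left (a b x : V p n) : dotP p n (a + b) x = dotP p n a x + dotP p n b x := by
  simp [dotP, add_mul, Finset.sum_add_distrib]

theorem dotP_add_right (a x y : V p n) : dotP p n a (x + y) = dotP p n a x + dotP p n a y := by
  simp [dotP, mul_add, Finset.sum_add_distrib]

theorem dotP_neg_right (a x : V p n) : dotP p n a (-x) = -dotP p n a x := by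
  simp [dotP]

theorem dotP_cont {X : Type*} [TopologicalSpace X] (a b : X → V p n) (ha : Continuous a)
    (hb : Continuous b) : Continuous (fun x => dotP p n (a x) (b x)) := by
  unfold dotP
  exact continuous_finsetSum _ fun i _ =>
    ((continuous_apply i).comp ha).mul ((continuous_apply i).comp hb)

theorem char_cont {X : Type*} [TopologicalSpace X] (a b : X → V p n) (ha : Continuous a)
    (hb : Continuous b) : Continuous (fun x => stdChar p (dotP p n (a x) (b x))) :=
  Continuous.comp (g := stdChar p) (f := fun x => dotP p n (a x) (b x))
    (stdChar_continuous p) (dotP_cont p n a b ha hb)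

theorem char_cont_left (z : V p n) : Continuous (fun ξ : V p n => stdChar p (dotP p n ξ z)) :=
  char_cont p n (fun ξ => ξ) (fun _ => z) continuous_id continuous_const

theorem char_cont_right (z : V p n) : Continuous (fun x : V p n => stdChar p (dotP p n z x)) :=
  char_cont p n (fun _ => z) (fun x => x) continuous_const continuous_id

theorem FT_cont (μ : Measure (V p n)) (f : V p n → ℂ) (hf : Integrable f μ) :
    Continuous (FT p n μ f) := by
  unfold FT
  refine continuous_of_dominated (bound := fun x => ‖f x‖) ?_ ?_ hf.norm ?_
  · intro ξ
    exact (char_cont_right p n ξ).aestronglyMeasurable.mul hf.1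
  · intro ξ
    refine Eventually.of_forall fun x => ?_
    rw [norm_mul, stdChar_norm, one_mul]
  · refine Eventually.of_forall fun x => ?_
    exact (char_cont_left p n x).mul continuous_const

theorem FJ_im (μ : Measure (V p n)) [μ.IsAddHaarMeasure] (J : V p n → ℝ) (hJ : HypA p n μ J)
    (ξ : V p n) : (FJ p n μ J ξ).im = 0 := by
  rw [← Complex.conj_eq_iff_im]
  unfold FJ FT
  rw [← integral_conj, ← integral_neg_eq_self]
  refine integral_congr_ae (Eventually.of_forall fun x => ?_)
  simp only [map_mul, Complex.conj_ofReal, stdChar_conj, dotP_neg_right, neg_neg]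
  rw [hJ.radial (-x) x (norm_neg x)]

open scoped ComplexOrder in
theorem subgroup_int_nonneg (μ : Measure (V p n)) [μ.IsAddHaarMeasure] (S : AddSubgroup (V p n))
    (hS : MeasurableSet (S : Set (V p n))) (z : V p n) :
    0 ≤ ∫ ξ in (S : Set (V p n)), stdChar p (dotP p n ξ z) ∂μ := by
  by_cases h : ∀ ξ ∈ S, stdChar p (dotP p n ξ z) = 1
  · rw [setIntegral_congr_fun hS (g := fun _ => (1 : ℂ)) h]
    exact integral_nonneg fun _ => zero_le_one
  · push Not at h
    obtain ⟨η, hη, hne⟩ := h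
    rw [← integral_indicator hS]
    set I := ∫ ξ, (S : Set (V p n)).indicator (fun ξ => stdChar p (dotP p n ξ z)) ξ ∂μ with hI
    have h1 : I = stdChar p (dotP p n η z) * I := by
      conv_lhs => rw [hI, ← integral_add_right_eq_self _ η]
      rw [hI, ← integral_const_mul]
      refine integral_congr_ae (Eventually.of_forall fun ξ => ?_)
      by_cases hξ : ξ ∈ S
      · have : ξ + η ∈ S := S.add_mem hξ hη
        simp [Set.indicator, hξ, this, dotP_add_left, stdChar_add, mul_comm]
      · have : ξ + η ∉ S := fun h => hξ ((S.add_mem_cancel_right hη).1 h)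
        simp [Set.indicator, hξ, this]
    have h2 : (1 - stdChar p (dotP p n η z)) * I = 0 := by linear_combination h1
    rcases mul_eq_zero.1 h2 with h3 | h3
    · exact absurd (sub_eq_zero.1 h3).symm hne
    · rw [h3]

/-- The superlevel subgroup. -/
def levelGroup (g : V p n → ℝ) (hg : ∀ ξ η : V p n, ‖ξ‖ ≤ ‖η‖ → g η ≤ g ξ) (R s : ℝ)
    (hR : 0 ≤ R) (hs : s < g 0) : AddSubgroup (V p n) where
  carrier := {ξ | ‖ξ‖ ≤ R ∧ s < g ξ}
  zero_mem' := ⟨by simpa using hR, hs⟩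
  neg_mem' := by
    rintro ξ ⟨h1, h2⟩
    exact ⟨by rwa [norm_neg], h2.trans_le (hg _ _ (norm_neg ξ).le)⟩
  add_mem' := by
    rintro ξ η ⟨h1, h2⟩ ⟨h3, h4⟩
    have h : ‖ξ + η‖ ≤ max ‖ξ‖ ‖η‖ := by
      rw [pi_norm_le_iff_of_nonneg (by positivity)]
      intro i
      refine (IsUltrametricDist.norm_add_le_max _ _).trans (max_le_max ?_ ?_) <;> exact norm_le_pi_norm _ i
    refine ⟨h.trans (max_le h1 h3), ?_⟩
    rcases le_total ‖ξ‖ ‖η‖ with h5 | h5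
    · rw [max_eq_right h5] at h
      exact h4.trans_le (hg _ _ h)
    · rw [max_eq_left h5] at h
      exact h2.trans_le (hg _ _ h)

open scoped ComplexOrder in
theorem kernel_nonneg (μ : Measure (V p n)) [μ.IsAddHaarMeasure] (g : V p n → ℝ)
    (hg : ∀ ξ η : V p n, ‖ξ‖ ≤ ‖η‖ → g η ≤ g ξ) (hgc : Continuous g) (hg0 : ∀ ξ, 0 ≤ g ξ)
    (R : ℝ) (hR : 0 ≤ R) (z : V p n) :
    0 ≤ ∫ ξ in Metric.closedBall (0 : V p n) R, stdChar p (dotP p n ξ z) * (g ξ : ℂ) ∂μ := by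
  have hgC : ∀ ξ, g ξ ≤ g 0 := fun ξ => hg 0 ξ (by simp)
  have : IsFiniteMeasure (μ.restrict (Metric.closedBall (0 : V p n) R)) :=
    ⟨by simpa using (isCompact_closedBall (0 : V p n) R).measure_lt_top⟩
  let F : V p n → ℝ → ℂ := fun ξ s =>
    if s < g ξ then stdChar p (dotP p n ξ z) else 0
  have hms : MeasurableSet {w : V p n × ℝ | w.2 < g w.1} :=
    measurableSet_lt measurable_snd (hgc.measurable.comp measurable_fst)
  have hF : Integrable (Function.uncurry F)
      ((μ.restrict (Metric.closedBall (0 : V p n) R)).prod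
        (volume.restrict (Set.Ioc 0 (g 0)))) := by
    refine Integrable.of_bound ?_ 1 ?_
    · refine Measurable.aestronglyMeasurable ?_
      exact Measurable.ite hms ((char_cont_left p n z).measurable.comp measurable_fst)
        measurable_const
    · refine Eventually.of_forall fun w => ?_
      simp only [Function.uncurry, F]
      split_ifs
      · exact (stdChar_norm p _).le
      · simp
  have h1 : ∀ ξ, stdChar p (dotP p n ξ z) * (g ξ : ℂ) = ∫ s in Set.Ioc 0 (g 0), F ξ s := by
    intro ξ
    have e : ∀ s, F ξ s = (Set.Iio (g ξ)).indicator (fun _ => stdChar p (dotP p n ξ z)) s := by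
      intro s; simp [F, Set.indicator]
    simp_rw [e]
    rw [setIntegral_indicator measurableSet_Iio]
    have e2 : (Set.Ioc 0 (g 0) ∩ Set.Iio (g ξ)) = Set.Ioo 0 (g ξ) := by
      ext s
      simp only [Set.mem_inter_iff, Set.mem_Ioc, Set.mem_Iio, Set.mem_Ioo]
      constructor
      · rintro ⟨⟨a, b⟩, c⟩; exact ⟨a, c⟩
      · rintro ⟨a, c⟩; exact ⟨⟨a, c.le.trans (hgC ξ)⟩, c⟩
    rw [e2, setIntegral_const, Measure.real, Real.volume_Ioo, sub_zero,
      ENNReal.toReal_ofReal (hg0 ξ), Complex.real_smul, mul_comm]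
  simp_rw [h1]
  rw [integral_integral_swap hF]
  refine integral_nonneg fun s => ?_
  have e : ∀ ξ, F ξ s = {ξ | s < g ξ}.indicator (fun ξ => stdChar p (dotP p n ξ z)) ξ := by
    intro ξ; simp [F, Set.indicator]
  simp_rw [e]
  have hm2 : MeasurableSet {ξ | s < g ξ} := measurableSet_lt measurable_const hgc.measurable
  rw [setIntegral_indicator hm2]
  by_cases hs : s < g 0
  · have e3 : Metric.closedBall (0 : V p n) R ∩ {ξ | s < g ξ} =
        (levelGroup p n g hg R s hR hs : Set (V p n)) := by
      ext ξ
      simp [levelGroup]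
    rw [e3]
    refine subgroup_int_nonneg p n μ _ ?_ z
    rw [← e3]
    exact Metric.isClosed_closedBall.measurableSet.inter hm2
  · have e3 : {ξ | s < g ξ} = ∅ := by
      ext ξ
      simp only [Set.mem_ofPred_eq, Set.mem_empty_iff_false, iff_false, not_lt]
      exact (hgC ξ).trans (not_lt.1 hs)
    rw [e3]
    simp

theorem unif_lc (w : V p n → ℝ) (hlc : IsLocallyConstant w) (hcs : HasCompactSupport w) :
    ∃ δ > 0, ∀ x h : V p n, ‖h‖ < δ → w (x + h) = w x := by
  obtain ⟨δ, hδ, H⟩ := lebesgue_number_lemma_of_metric (c := fun c : ℝ => w ⁻¹' {c}) hcs.isCompact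
    (fun c => hlc.isOpen_fiber c) (fun x _ => Set.mem_iUnion.2 ⟨w x, rfl⟩)
  have key : ∀ x ∈ tsupport w, ∀ h : V p n, ‖h‖ < δ → w (x + h) = w x := by
    intro x hx h hh
    obtain ⟨c, hc⟩ := H x hx
    have a1 : w x = c := hc (Metric.mem_ball_self hδ)
    have a2 : w (x + h) = c := hc (by simpa [Metric.mem_ball, dist_eq_norm] using hh)
    rw [a1, a2]
  refine ⟨δ, hδ, fun x h hh => ?_⟩
  by_cases hx : x ∈ tsupport w
  · exact key x hx h hh
  · by_cases hx2 : x + h ∈ tsupport w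
    · have := key _ hx2 (-h) (by rwa [norm_neg])
      rw [add_neg_cancel_right] at this
      exact this.symm
    · rw [image_eq_zero_of_notMem_tsupport hx, image_eq_zero_of_notMem_tsupport hx2]

theorem FT_support (μ : Measure (V p n)) [μ.IsAddHaarMeasure] (w : V p n → ℝ)
    (hlc : IsLocallyConstant w) (hcs : HasCompactSupport w) :
    ∃ R : ℝ, ∀ ξ : V p n, R < ‖ξ‖ → FT p n μ (fun y => (w y : ℂ)) ξ = 0 := by
  obtain ⟨δ, hδ, H⟩ := unif_lc p n w hlc hcs
  have hp1 : (1 : ℝ) < p := by exact_mod_cast (Fact.out : p.Prime).one_lt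
  refine ⟨p / δ, fun ξ hξ => ?_⟩
  have hpos : 0 < ‖ξ‖ := lt_trans (by positivity) hξ
  obtain ⟨i, hi⟩ : ∃ i, p / δ < ‖ξ i‖ := by
    by_contra hcon
    push Not at hcon
    exact absurd ((pi_norm_le_iff_of_nonneg (by positivity)).2 hcon) (not_le.2 hξ)
  have hξi : 0 < ‖ξ i‖ := lt_trans (by positivity) hi
  have hξi0 : ξ i ≠ 0 := norm_pos_iff.1 hξi
  have hp0 : (p : ℚ_[p]) ≠ 0 := by exact_mod_cast (Fact.out : p.Prime).ne_zero
  let h : V p n := Pi.single i ((p : ℚ_[p])⁻¹ * (ξ i)⁻¹)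
  have hdot : dotP p n ξ h = (p : ℚ_[p])⁻¹ := by
    unfold dotP
    rw [Finset.sum_eq_single i]
    · simp only [h, Pi.single_eq_same]
      field_simp
    · intro j _ hj
      simp [h, hj]
    · simp
  have hh : ‖h‖ < δ := by
    have : ‖h‖ ≤ p / ‖ξ i‖ := by
      rw [pi_norm_le_iff_of_nonneg (by positivity)]
      intro j
      by_cases hj : j = i
      · subst hj
        simp only [h, Pi.single_eq_same, norm_mul, norm_inv, Padic.norm_p, inv_inv]
        rw [div_eq_mul_inv]
      · simp only [h, Pi.single_eq_of_ne hj, norm_zero]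
        positivity
    refine this.trans_lt ?_
    rw [div_lt_iff₀ hξi]
    rw [div_lt_iff₀ hδ] at hi
    linarith
  have hne : stdChar p (dotP p n ξ h) ≠ 1 := by
    intro hc
    have := norm_le_of_stdChar_eq_one p _ hc
    rw [hdot, norm_inv, Padic.norm_p, inv_inv] at this
    linarith
  set I := FT p n μ (fun y => (w y : ℂ)) ξ with hI
  have h1 : I = stdChar p (dotP p n ξ h) * I := by
    conv_lhs => rw [hI, FT, ← integral_add_right_eq_self _ h]
    rw [hI, FT, ← integral_const_mul]
    refine integral_congr_ae (Eventually.of_forall fun y => ?_)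
    simp only [H y h hh, dotP_add_right, stdChar_add]
    ring
  have h2 : (1 - stdChar p (dotP p n ξ h)) * I = 0 := by linear_combination h1
  rcases mul_eq_zero.1 h2 with h3 | h3
  · exact absurd (sub_eq_zero.1 h3).symm hne
  · exact h3

theorem lc_integrable (μ : Measure (V p n)) [μ.IsAddHaarMeasure] (w : V p n → ℝ)
    (hlc : IsLocallyConstant w) (hcs : HasCompactSupport w) :
    Integrable (fun y => (w y : ℂ)) μ :=
  (hlc.continuous.integrable_of_hasCompactSupport hcs).ofReal

theorem sol_integrable (μ : Measure (V p n)) [μ.IsAddHaarMeasure] (g : V p n → ℝ)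
    (hgc : Continuous g) (w : V p n → ℝ)
    (hlc : IsLocallyConstant w) (hcs : HasCompactSupport w) (x : V p n) :
    Integrable (fun ξ => stdChar p (-(dotP p n ξ x)) * (g ξ : ℂ) *
      FT p n μ (fun y => (w y : ℂ)) ξ) μ := by
  obtain ⟨R, hR⟩ := FT_support p n μ w hlc hcs
  refine Continuous.integrable_of_hasCompactSupport ?_ ?_
  · refine Continuous.mul (Continuous.mul ?_ ?_) (FT_cont p n μ _ (lc_integrable p n μ w hlc hcs))
    · simp_rw [← dotP_neg_right]
      exact char_cont_left p n (-x)
    · exact Complex.continuous_ofReal.comp hgc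
  · refine HasCompactSupport.intro (isCompact_closedBall (0 : V p n) R) fun ξ hξ => ?_
    rw [hR ξ (by simpa using hξ), mul_zero]

open scoped ComplexOrder in
theorem sol_nonneg (μ : Measure (V p n)) [μ.IsAddHaarMeasure] (g : V p n → ℝ)
    (hg : ∀ ξ η : V p n, ‖ξ‖ ≤ ‖η‖ → g η ≤ g ξ) (hgc : Continuous g) (hg0 : ∀ ξ, 0 ≤ g ξ)
    (w : V p n → ℝ) (hw : ∀ y, 0 ≤ w y)
    (hlc : IsLocallyConstant w) (hcs : HasCompactSupport w) (x : V p n) :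
    0 ≤ ∫ ξ, stdChar p (-(dotP p n ξ x)) * (g ξ : ℂ) *
      FT p n μ (fun y => (w y : ℂ)) ξ ∂μ := by
  obtain ⟨R₀, hR₀⟩ := FT_support p n μ w hlc hcs
  set R := max R₀ 0 with hRdef
  have hgC : ∀ ξ, g ξ ≤ g 0 := fun ξ => hg 0 ξ (by simp)
  have hR0 : 0 ≤ R := le_max_right _ _
  have : IsFiniteMeasure (μ.restrict (Metric.closedBall (0 : V p n) R)) :=
    ⟨by simpa using (isCompact_closedBall (0 : V p n) R).measure_lt_top⟩
  have hwi := lc_integrable p n μ w hlc hcs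
  rw [← setIntegral_eq_integral_of_forall_compl_eq_zero (s := Metric.closedBall (0 : V p n) R)]
  swap
  · intro ξ hξ
    have : R < ‖ξ‖ := by simpa using hξ
    rw [hR₀ ξ ((le_max_left _ _).trans_lt this), mul_zero]
  let F : V p n → V p n → ℂ := fun ξ y =>
    stdChar p (dotP p n ξ (y + -x)) * (g ξ : ℂ) * (w y : ℂ)
  have h1 : ∀ ξ, stdChar p (-(dotP p n ξ x)) * (g ξ : ℂ) *
      FT p n μ (fun y => (w y : ℂ)) ξ = ∫ y, F ξ y ∂μ := by
    intro ξ
    rw [FT, ← integral_const_mul]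
    refine integral_congr_ae (Eventually.of_forall fun y => ?_)
    simp only [F, dotP_add_right, stdChar_add, dotP_neg_right]
    ring
  have hF : Integrable (Function.uncurry F)
      ((μ.restrict (Metric.closedBall (0 : V p n) R)).prod μ) := by
    have hb : Integrable (fun z : V p n × V p n => ((g 0 : ℝ) : ℂ) * (w z.2 : ℂ))
        ((μ.restrict (Metric.closedBall (0 : V p n) R)).prod μ) :=
      (integrable_const ((g 0 : ℝ) : ℂ)).mul_prod hwi
    refine hb.mono ?_ ?_
    · refine Continuous.aestronglyMeasurable ?_
      have c1 : Continuous fun z : V p n × V p n => stdChar p (dotP p n z.1 (z.2 + -x)) :=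
        char_cont p n (fun z : V p n × V p n => z.1) (fun z => z.2 + -x) continuous_fst
          (continuous_snd.add continuous_const)
      have c2 : Continuous fun z : V p n × V p n => (g z.1 : ℂ) := by fun_prop
      have c3 : Continuous fun z : V p n × V p n => (w z.2 : ℂ) :=
        Complex.continuous_ofReal.comp (hlc.continuous.comp continuous_snd)
      exact (c1.mul c2).mul c3
    · refine Eventually.of_forall fun z => ?_
      simp only [Function.uncurry, F, norm_mul, stdChar_norm, one_mul, Complex.norm_real]
      gcongr
      rw [Real.norm_of_nonneg (hg0 _), Real.norm_of_nonneg (hg0 _)]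
      exact hgC _
  simp_rw [h1]
  rw [integral_integral_swap hF]
  refine integral_nonneg fun y => ?_
  simp only [F]
  rw [integral_mul_const]
  exact mul_nonneg (kernel_nonneg p n μ g hg hgc hg0 R hR0 _)
    (Complex.zero_le_real.2 (hw y))

/-- comparison principle: with `u₀ ≥ v₀` locally constant compactly supported
initial data, the corresponding solutions satisfy `u(x,t) ≥ v(x,t)` for all `x` and `t ≥ 0`
(the difference is a nonnegative real number). -/
theorem statement10 (hn : 0 < n) (μ : Measure (V p n)) [μ.IsAddHaarMeasure]
    (hμ : μ (Zpn p n) = 1) (J : V p n → ℝ) (hJ : HypA p n μ J)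
    (hmono : ∀ ξ η : V p n, ‖ξ‖ ≤ ‖η‖ →
      (1 - FJ p n μ J ξ).re ≤ (1 - FJ p n μ J η).re)
    (u₀ v₀ : V p n → ℝ) (hu₀lc : IsLocallyConstant u₀) (hu₀cs : HasCompactSupport u₀)
    (hv₀lc : IsLocallyConstant v₀) (hv₀cs : HasCompactSupport v₀)
    (hle : ∀ x : V p n, v₀ x ≤ u₀ x) :
    ∀ (x : V p n) (t : ℝ), 0 ≤ t →
      ((∫ ξ, stdChar p (-(dotP p n ξ x)) * Complex.exp (-(t : ℂ) * (1 - FJ p n μ J ξ)) *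
          FT p n μ (fun y => (u₀ y : ℂ)) ξ ∂μ) -
       (∫ ξ, stdChar p (-(dotP p n ξ x)) * Complex.exp (-(t : ℂ) * (1 - FJ p n μ J ξ)) *
          FT p n μ (fun y => (v₀ y : ℂ)) ξ ∂μ)).im = 0 ∧
      0 ≤ ((∫ ξ, stdChar p (-(dotP p n ξ x)) * Complex.exp (-(t : ℂ) * (1 - FJ p n μ J ξ)) *
          FT p n μ (fun y => (u₀ y : ℂ)) ξ ∂μ) -
       (∫ ξ, stdChar p (-(dotP p n ξ x)) * Complex.exp (-(t : ℂ) * (1 - FJ p n μ J ξ)) *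
          FT p n μ (fun y => (v₀ y : ℂ)) ξ ∂μ)).re := by
  intro x t ht
  have hFJc : Continuous (FJ p n μ J) := FT_cont p n μ _ hJ.integrable.ofReal
  let g : V p n → ℝ := fun ξ => Real.exp (-t * (1 - (FJ p n μ J ξ).re))
  have hgc : Continuous g := by
    have := Complex.continuous_re.comp hFJc
    exact Real.continuous_exp.comp (continuous_const.mul (continuous_const.sub this))
  have hg : ∀ ξ η : V p n, ‖ξ‖ ≤ ‖η‖ → g η ≤ g ξ := by
    intro ξ η h
    have h1 := hmono ξ η h
    simp only [Complex.sub_re, Complex.one_re] at h1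
    have h2 := mul_le_mul_of_nonneg_left h1 ht
    exact Real.exp_le_exp.2 (by linarith)
  have hexp : ∀ ξ, Complex.exp (-(t : ℂ) * (1 - FJ p n μ J ξ)) = (g ξ : ℂ) := by
    intro ξ
    have h1 : FJ p n μ J ξ = ((FJ p n μ J ξ).re : ℂ) :=
      (Complex.conj_eq_iff_re.1 (Complex.conj_eq_iff_im.2 (FJ_im p n μ J hJ ξ))).symm
    rw [h1]
    simp only [g]
    push_cast
    simp
  simp_rw [hexp]
  rw [← integral_sub (sol_integrable p n μ g hgc u₀ hu₀lc hu₀cs x)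
    (sol_integrable p n μ g hgc v₀ hv₀lc hv₀cs x)]
  have hlc : IsLocallyConstant (u₀ - v₀) := hu₀lc.sub hv₀lc
  have hcs : HasCompactSupport (u₀ - v₀) := by
    rw [sub_eq_add_neg]
    exact hu₀cs.add hv₀cs.neg
  have key := sol_nonneg p n μ g hg hgc (fun ξ => (Real.exp_pos _).le) (u₀ - v₀)
    (fun y => sub_nonneg.2 (hle y)) hlc hcs x
  have hrw : ∀ ξ, stdChar p (-(dotP p n ξ x)) * (g ξ : ℂ) * FT p n μ (fun y => (u₀ y : ℂ)) ξ -
      stdChar p (-(dotP p n ξ x)) * (g ξ : ℂ) * FT p n μ (fun y => (v₀ y : ℂ)) ξ =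
      stdChar p (-(dotP p n ξ x)) * (g ξ : ℂ) *
        FT p n μ (fun y => (((u₀ - v₀) y : ℝ) : ℂ)) ξ := by
    intro ξ
    rw [← mul_sub]
    congr 1
    unfold FT
    have hi : ∀ w : V p n → ℝ, IsLocallyConstant w → HasCompactSupport w →
        Integrable (fun y => stdChar p (dotP p n ξ y) * (w y : ℂ)) μ := by
      intro w hl hc
      refine Continuous.integrable_of_hasCompactSupport ?_ ?_
      · exact (char_cont_right p n ξ).mul (Complex.continuous_ofReal.comp hl.continuous)
      · exact HasCompactSupport.intro hc.isCompact fun y hy => by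
          rw [image_eq_zero_of_notMem_tsupport hy]; simp
    rw [← integral_sub (hi u₀ hu₀lc hu₀cs) (hi v₀ hv₀lc hv₀cs)]
    refine integral_congr_ae (Eventually.of_forall fun y => ?_)
    simp only [Pi.sub_apply]
    push_cast
    ring
  simp_rw [hrw]
  rw [Complex.le_def] at key
  exact ⟨key.2.symm, key.1⟩

end PadicPaper
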